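/- For every mesh element T ∈ T_h and every v ∈ H¹(T)^d, the local Darcy velocity reconstruction applied to the local interpolate coincides with the Raviart–Thomas–Nédélec interpolator of degree k: r_{D,T}^k I_T^k v = I_{RTN,T}^k v. -/

import Mathlib

/-!
STATEMENT 9 (link with the Raviart–Thomas–Nédélec interpolator).
For every mesh element T ∈ T_h and every v ∈ H¹(T)^d,
r_{D,T}^k I_T^k v = I_{RTN,T}^k v.
The local interpolate, the Darcy velocity reconstruction and the RTN interpolator are each
characterised by their defining (uniquely solvable) equations, and the theorem is
quantified over any objects satisfying them; H¹-regularity of v is rendered classically by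
C¹-regularity on the closed element.  The conclusion is equality on the element.
-/

noncomputable section
open MeasureTheory
open scoped RealInnerProductSpace Classical

namespace HHO

abbrev Vec (d : ℕ) := EuclideanSpace ℝ (Fin d)

variable {d : ℕ}

/-- Surface measure: the (d−1)-dimensional Hausdorff measure. -/
def sμ (d : ℕ) : Measure (Vec d) := μH[(d : ℝ) - 1]

def gradEntry (u : Vec d → Vec d) (x : Vec d) (i j : Fin d) : ℝ :=
  fderiv ℝ u x (EuclideanSpace.single j 1) i

/-- Symmetric gradient entries. -/
def sg (u : Vec d → Vec d) (x : Vec d) (i j : Fin d) : ℝ :=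
  (gradEntry u x i j + gradEntry u x j i) / 2

/-- Skew-symmetric gradient entries. -/
def ssg (u : Vec d → Vec d) (x : Vec d) (i j : Fin d) : ℝ :=
  (gradEntry u x i j - gradEntry u x j i) / 2

/-- Frobenius inner product of matrices. -/
def mdot (A B : Fin d → Fin d → ℝ) : ℝ := ∑ i, ∑ j, A i j * B i j

def divg (u : Vec d → Vec d) (x : Vec d) : ℝ := ∑ i, gradEntry u x i i

def gradS (q : Vec d → ℝ) (x : Vec d) (i : Fin d) : ℝ :=
  fderiv ℝ q x (EuclideanSpace.single i 1)

/-- i-th component of ∇·(∇_s w). -/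
def divSymGrad (w : Vec d → Vec d) (x : Vec d) (i : Fin d) : ℝ :=
  ∑ j, fderiv ℝ (fun y => sg w y i j) x (EuclideanSpace.single j 1)

def PolyDeg (d ℓ : ℕ) (f : Vec d → ℝ) : Prop :=
  ∃ p : MvPolynomial (Fin d) ℝ, p.totalDegree ≤ ℓ ∧
    ∀ x, f x = MvPolynomial.eval (fun j => x j) p

def VPolyDeg (d ℓ : ℕ) (v : Vec d → Vec d) : Prop :=
  ∀ i, PolyDeg d ℓ (fun x => v x i)

/-- Member of the Raviart–Thomas–Nédélec space RTN^k = P^k(T)^d + x P^k(T). -/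
def IsRTN (d k : ℕ) (v : Vec d → Vec d) : Prop :=
  ∃ a q, VPolyDeg d k a ∧ PolyDeg d k q ∧ ∀ x : Vec d, v x = a x + q x • x

/-- A conforming simplicial mesh: simplices given by vertices, with outward unit face
normals, pairwise disjoint interiors and matching interfaces. -/
structure Mesh (d : ℕ) where
  nE : ℕ
  nE_pos : 0 < nE
  vtx : Fin nE → Fin (d + 1) → Vec d
  indep : ∀ t, AffineIndependent ℝ (vtx t)
  nrm : Fin nE → Fin (d + 1) → Vec d
  nrm_unit : ∀ t i, ‖nrm t i‖ = 1
  nrm_orth : ∀ t i j j', j ≠ i → j' ≠ i → ⟪vtx t j - vtx t j', nrm t i⟫ = (0 : ℝ)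
  nrm_out : ∀ t i j, j ≠ i → ⟪vtx t i - vtx t j, nrm t i⟫ < (0 : ℝ)
  disj : ∀ t t', t ≠ t' →
    interior (convexHull ℝ (Set.range (vtx t))) ∩
      interior (convexHull ℝ (Set.range (vtx t'))) = ∅
  conforming : ∀ t t', t ≠ t' →
    convexHull ℝ (Set.range (vtx t)) ∩ convexHull ℝ (Set.range (vtx t'))
      = convexHull ℝ (Set.range (vtx t) ∩ Set.range (vtx t'))

namespace Mesh

variable (M : Mesh d)

/-- The (open) element T. -/
def cell (t : Fin M.nE) : Set (Vec d) :=
  interior (convexHull ℝ (Set.range (M.vtx t)))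

/-- The (closed) face of T opposite to vertex i. -/
def face (t : Fin M.nE) (i : Fin (d + 1)) : Set (Vec d) :=
  convexHull ℝ (M.vtx t '' {i}ᶜ)

/-- The computational domain (closed). -/
def domain : Set (Vec d) := ⋃ t, convexHull ℝ (Set.range (M.vtx t))

/-- Element diameter h_T. -/
def hT (t : Fin M.nE) : ℝ := Metric.diam (M.cell t)

/-- Face diameter h_F. -/
def hF (t : Fin M.nE) (i : Fin (d + 1)) : ℝ := Metric.diam (M.face t i)

def IsBoundaryFace (t : Fin M.nE) (i : Fin (d + 1)) : Prop :=
  M.face t i ⊆ frontier M.domain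

/-- Mesh regularity with parameter ϱ: each element contains a ball of radius h_T/ϱ. -/
def Regular (ϱ : ℝ) : Prop :=
  ∀ t, ∃ c, Metric.ball c (M.hT t / ϱ) ⊆ M.cell t

end Mesh

/-- A local tuple of discrete velocity unknowns on one element. -/
abbrev Tup (d : ℕ) := (Vec d → Vec d) × (Fin (d + 1) → Vec d → Vec d)

/-- Discrete velocity unknowns on the whole mesh: element polynomials of degree ≤ l and
single-valued face polynomials of degree ≤ k. -/
structure DiscVel (M : Mesh d) (k l : ℕ) where
  el : Fin M.nE → Vec d → Vec d
  fa : Fin M.nE → Fin (d + 1) → Vec d → Vec d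
  el_poly : ∀ t, VPolyDeg d l (el t)
  fa_poly : ∀ t i, VPolyDeg d k (fa t i)
  fa_single : ∀ t i t' i', M.face t i = M.face t' i' →
    Set.EqOn (fa t i) (fa t' i') (M.face t i)

/-- The local tuple of a discrete velocity on element t. -/
def DiscVel.loc {M : Mesh d} {k l : ℕ} (v : DiscVel M k l) (t : Fin M.nE) : Tup d :=
  (v.el t, v.fa t)

/-- Strongly enforced homogeneous boundary condition (space U_{h,0}^k). -/
def DiscVel.Zb {M : Mesh d} {k l : ℕ} (v : DiscVel M k l) : Prop :=
  ∀ t i, M.IsBoundaryFace t i → ∀ x ∈ M.face t i, v.fa t i x = 0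

/-- `P` is the L²-orthogonal projection of `v` on P^ℓ(T)^d, T = cell t. -/
def IsL2ProjCell (M : Mesh d) (t : Fin M.nE) (ℓ : ℕ) (v P : Vec d → Vec d) : Prop :=
  VPolyDeg d ℓ P ∧ ∀ w, VPolyDeg d ℓ w → ∫ x in M.cell t, ⟪v x - P x, w x⟫ = (0 : ℝ)

/-- `P` is the L²-orthogonal projection of `v` on P^ℓ(F)^d, F = face t i. -/
def IsL2ProjFace (M : Mesh d) (t : Fin M.nE) (i : Fin (d + 1)) (ℓ : ℕ)
    (v P : Vec d → Vec d) : Prop :=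
  VPolyDeg d ℓ P ∧ ∀ w, VPolyDeg d ℓ w →
    ∫ x in M.face t i, ⟪v x - P x, w x⟫ ∂(sμ d) = (0 : ℝ)

/-- `u` is the local interpolate I_T^k v = (π^l_T v, (π^k_F v)_F). -/
def IsInterp (M : Mesh d) (k l : ℕ) (t : Fin M.nE) (v : Vec d → Vec d)
    (u : Tup d) : Prop :=
  IsL2ProjCell M t l v u.1 ∧ ∀ i, IsL2ProjFace M t i k v (u.2 i)

/-- `R` is the Darcy velocity reconstruction r_{D,T}^k u. -/
def IsDarcyRec (M : Mesh d) (k : ℕ) (t : Fin M.nE) (u : Tup d)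
    (R : Vec d → Vec d) : Prop :=
  IsRTN d k R ∧
  (∀ w, VPolyDeg d (k - 1) w → ∫ x in M.cell t, ⟪R x - u.1 x, w x⟫ = (0 : ℝ)) ∧
  (∀ i, ∀ q, PolyDeg d k q →
    ∫ x in M.face t i, (⟪R x, M.nrm t i⟫ - ⟪u.2 i x, M.nrm t i⟫) * q x ∂(sμ d)
      = (0 : ℝ))

/-- `R` is the Stokes velocity reconstruction r_{S,T}^{k+1} u. -/
def IsStokesRec (M : Mesh d) (k : ℕ) (t : Fin M.nE) (u : Tup d)
    (R : Vec d → Vec d) : Prop :=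
  VPolyDeg d (k + 1) R ∧
  (∀ w, VPolyDeg d (k + 1) w →
    ∫ x in M.cell t, mdot (sg R x) (sg w x)
      = -(∫ x in M.cell t, ∑ a, u.1 x a * divSymGrad w x a)
        + ∑ i, ∫ x in M.face t i,
            (∑ a, u.2 i x a * ∑ b, sg w x a b * M.nrm t i b) ∂(sμ d)) ∧
  (∀ a, ∫ x in M.cell t, R x a = ∫ x in M.cell t, u.1 x a) ∧
  (∀ a b, ∫ x in M.cell t, ssg R x a b
      = (1 / 2) * ∑ i, ∫ x in M.face t i,
          (u.2 i x a * M.nrm t i b - M.nrm t i a * u.2 i x b) ∂(sμ d))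

/-- `P` is the strain projector E_T^ℓ v on T = cell t. -/
def IsStrainProj (M : Mesh d) (t : Fin M.nE) (ℓ : ℕ) (v P : Vec d → Vec d) : Prop :=
  VPolyDeg d ℓ P ∧
  (∀ w, VPolyDeg d ℓ w →
      ∫ x in M.cell t, mdot (sg P x) (sg w x)
        = ∫ x in M.cell t, mdot (sg v x) (sg w x)) ∧
  (∀ i, ∫ x in M.cell t, P x i = ∫ x in M.cell t, v x i) ∧
  (∀ i j, ∫ x in M.cell t, ssg P x i j = ∫ x in M.cell t, ssg v x i j)

/-- `Q` is the Raviart–Thomas–Nédélec interpolate I_{RTN,T}^k v. -/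
def IsRTNInterp (M : Mesh d) (k : ℕ) (t : Fin M.nE) (v Q : Vec d → Vec d) : Prop :=
  IsRTN d k Q ∧
  (∀ w, VPolyDeg d (k - 1) w → ∫ x in M.cell t, ⟪v x - Q x, w x⟫ = (0 : ℝ)) ∧
  (∀ i, ∀ q, PolyDeg d k q →
    ∫ x in M.face t i, (⟪v x, M.nrm t i⟫ - ⟪Q x, M.nrm t i⟫) * q x ∂(sμ d) = (0 : ℝ))

/-- `DT`, `DF` are the Darcy difference operators δ_{D,T} u, δ_{D,TF} u associated with
the Darcy reconstruction `R` of `u`. -/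
def IsDarcyDiff (M : Mesh d) (k l : ℕ) (t : Fin M.nE) (u : Tup d)
    (R DT : Vec d → Vec d) (DF : Fin (d + 1) → Vec d → Vec d) : Prop :=
  IsL2ProjCell M t l (fun x => R x - u.1 x) DT ∧
  ∀ i, IsL2ProjFace M t i k (fun x => R x - u.2 i x) (DF i)

/-- Value of the Darcy stabilisation s_{D,T}(u,u) given the difference operators. -/
def sDval (M : Mesh d) (t : Fin M.nE) (ν : ℝ) (DT : Vec d → Vec d)
    (DF : Fin (d + 1) → Vec d → Vec d) : ℝ :=
  ν * (∫ x in M.cell t, ‖DT x‖ ^ 2) +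
  ∑ i, if M.IsBoundaryFace t i then 0
       else ν * M.hF t i * ∫ x in M.face t i, ‖DF i x‖ ^ 2 ∂(sμ d)

/-- Value of the local Darcy bilinear form a_{D,T}(u,u). -/
def aDval (M : Mesh d) (t : Fin M.nE) (ν : ℝ) (R DT : Vec d → Vec d)
    (DF : Fin (d + 1) → Vec d → Vec d) : ℝ :=
  ν * (∫ x in M.cell t, ‖R x‖ ^ 2) + sDval M t ν DT DF

/-- Squared boundary seminorm |u|²_{1,∂T}. -/
def bSemiSq (M : Mesh d) (t : Fin M.nE) (u : Tup d) : ℝ :=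
  ∑ i, (M.hF t i)⁻¹ * ∫ x in M.face t i, ‖u.2 i x - u.1 x‖ ^ 2 ∂(sμ d)

/-- Squared local strain seminorm ‖u‖²_{ε,T}. -/
def eSemiSq (M : Mesh d) (t : Fin M.nE) (u : Tup d) : ℝ :=
  (∫ x in M.cell t, mdot (sg u.1 x) (sg u.1 x)) + bSemiSq M t u

/-- The velocity–pressure coupling bilinear form b_h. -/
def bh (M : Mesh d) {k l : ℕ} (v : DiscVel M k l) (q : Fin M.nE → Vec d → ℝ) : ℝ :=
  ∑ t, ((∫ x in M.cell t, ∑ a, v.el t x a * gradS (q t) x a)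
    - ∑ i, ∫ x in M.face t i, (∑ a, v.fa t i x a * M.nrm t i a) * q t x ∂(sμ d))

/-- Broken polynomial pressures of degree ≤ k. -/
def BrokenPoly (M : Mesh d) (k : ℕ) (q : Fin M.nE → Vec d → ℝ) : Prop :=
  ∀ t, PolyDeg d k (q t)

/-- Squared H^m(T)-seminorm, with derivatives taken within the closed element. -/
def semiSq (M : Mesh d) (t : Fin M.nE) (m : ℕ) (v : Vec d → Vec d) : ℝ :=
  ∫ x in M.cell t,
    ‖iteratedFDerivWithin ℝ m v (convexHull ℝ (Set.range (M.vtx t))) x‖ ^ 2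

/-- Local friction coefficient C_{f,T} = ν_T h_T² / (2 μ_T). -/
def frictionCoef (M : Mesh d) (t : Fin M.nE) (ν μ : ℝ) : ℝ :=
  ν * M.hT t ^ 2 / (2 * μ)

/-- min(1, C_f) cutoff. -/
def cutD (Cf : ℝ) : ℝ := min 1 Cf

/-- min(1, C_f⁻¹) cutoff, with the convention C_f⁻¹ = +∞ (cutoff = 1) when C_f = 0. -/
def cutS (Cf : ℝ) : ℝ := if Cf = 0 then 1 else min 1 Cf⁻¹

section Polynomials

variable {ℓ ℓ' : ℕ} {f g : Vec d → ℝ} {a b : Vec d → Vec d}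

theorem PolyDeg.mono (hf : PolyDeg d ℓ f) (h : ℓ ≤ ℓ') : PolyDeg d ℓ' f := by
  obtain ⟨p, hp, hfp⟩ := hf
  exact ⟨p, hp.trans h, hfp⟩

theorem PolyDeg.const (ℓ : ℕ) (c : ℝ) : PolyDeg d ℓ (fun _ => c) :=
  ⟨MvPolynomial.C c, by simp, by simp⟩

theorem PolyDeg.coord (i : Fin d) : PolyDeg d 1 (fun x => x i) :=
  ⟨MvPolynomial.X i, by simp, by simp⟩

theorem PolyDeg.add (hf : PolyDeg d ℓ f) (hg : PolyDeg d ℓ g) :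
    PolyDeg d ℓ (fun x => f x + g x) := by
  obtain ⟨p, hp, hfp⟩ := hf
  obtain ⟨q, hq, hgq⟩ := hg
  exact ⟨p + q, (MvPolynomial.totalDegree_add p q).trans (max_le hp hq),
    fun x => by simp [hfp, hgq]⟩

theorem PolyDeg.mul (hf : PolyDeg d ℓ f) (hg : PolyDeg d ℓ' g) :
    PolyDeg d (ℓ + ℓ') (fun x => f x * g x) := by
  obtain ⟨p, hp, hfp⟩ := hf
  obtain ⟨q, hq, hgq⟩ := hg
  exact ⟨p * q, (MvPolynomial.totalDegree_mul p q).trans (add_le_add hp hq),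
    fun x => by simp [hfp, hgq]⟩

theorem PolyDeg.mul_const (hf : PolyDeg d ℓ f) (c : ℝ) : PolyDeg d ℓ (fun x => f x * c) :=
  hf.mul (PolyDeg.const 0 c)

theorem PolyDeg.sub (hf : PolyDeg d ℓ f) (hg : PolyDeg d ℓ g) :
    PolyDeg d ℓ (fun x => f x - g x) := by
  simpa [sub_eq_add_neg] using hf.add (hg.mul_const (-1))

theorem PolyDeg.sum {ι : Type*} (s : Finset ι) {F : ι → Vec d → ℝ}
    (hF : ∀ i ∈ s, PolyDeg d ℓ (F i)) : PolyDeg d ℓ (fun x => ∑ i ∈ s, F i x) := by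
  induction s using Finset.induction_on with
  | empty => simpa using PolyDeg.const ℓ 0
  | insert i s his ih =>
    simp only [Finset.sum_insert his]
    exact (hF i (by simp)).add (ih fun j hj => hF j (by simp [hj]))

theorem PolyDeg.continuous (hf : PolyDeg d ℓ f) : Continuous f := by
  obtain ⟨p, -, hfp⟩ := hf
  rw [funext hfp]
  exact (MvPolynomial.continuous_eval p).comp (by fun_prop)

theorem VPolyDeg.mono (ha : VPolyDeg d ℓ a) (h : ℓ ≤ ℓ') : VPolyDeg d ℓ' a :=
  fun i => (ha i).mono h

theorem VPolyDeg.sub (ha : VPolyDeg d ℓ a) (hb : VPolyDeg d ℓ b) :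
    VPolyDeg d ℓ (fun x => a x - b x) :=
  fun i => (ha i).sub (hb i)

theorem VPolyDeg.continuous (ha : VPolyDeg d ℓ a) : Continuous a :=
  (PiLp.continuous_toLp 2 _).comp (continuous_pi fun i => (ha i).continuous)

theorem VPolyDeg.inner_const (ha : VPolyDeg d ℓ a) (c : Vec d) :
    PolyDeg d ℓ (fun x => ⟪a x, c⟫) := by
  have h : (fun x => ⟪a x, c⟫) = fun x => ∑ i, a x i * c i := by
    funext x
    simp [PiLp.inner_apply, mul_comm]
  rw [h]
  exact PolyDeg.sum _ fun i _ => (ha i).mul_const _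

theorem PolyDeg.smul_const (hf : PolyDeg d ℓ f) (c : Vec d) :
    VPolyDeg d ℓ (fun x => f x • c) :=
  fun i => hf.mul_const (c i)

theorem VPolyDeg.sum {ι : Type*} (s : Finset ι) {F : ι → Vec d → Vec d}
    (hF : ∀ i ∈ s, VPolyDeg d ℓ (F i)) : VPolyDeg d ℓ (fun x => ∑ i ∈ s, F i x) := by
  intro j
  simpa using PolyDeg.sum s fun i hi => hF i hi j

theorem IsRTN.continuous {k : ℕ} (ha : IsRTN d k a) : Continuous a := by
  obtain ⟨c, q, hc, hq, h⟩ := ha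
  rw [funext h]
  exact hc.continuous.add (hq.continuous.smul continuous_id)

theorem IsRTN.sub {k : ℕ} (ha : IsRTN d k a) (hb : IsRTN d k b) :
    IsRTN d k (fun x => a x - b x) := by
  obtain ⟨c, q, hc, hq, h⟩ := ha
  obtain ⟨c', q', hc', hq', h'⟩ := hb
  refine ⟨_, _, hc.sub hc', hq.sub hq', fun x => ?_⟩
  simp only [h, h', sub_smul]
  abel

/-- A polynomial vanishing on a nonempty open set is zero. -/
theorem mvPolynomial_eq_zero_of_eval_eq_zero_on_open {p : MvPolynomial (Fin d) ℝ}
    {U : Set (Vec d)} (hU : IsOpen U) (hne : U.Nonempty)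
    (h : ∀ x ∈ U, MvPolynomial.eval (fun j => x j) p = 0) : p = 0 := by
  obtain ⟨x₀, hx₀⟩ := hne
  have hV : IsOpen ((fun y : Fin d → ℝ => (WithLp.toLp 2 y : Vec d)) ⁻¹' U) :=
    hU.preimage (PiLp.continuous_toLp 2 _)
  obtain ⟨ε, hε, hball⟩ := Metric.isOpen_iff.1 hV (fun j => x₀ j) hx₀
  refine MvPolynomial.funext_set (fun j => Metric.ball (x₀ j) ε) ?_ fun y hy => ?_
  · intro j
    rw [Real.ball_eq_Ioo]
    exact Set.Ioo_infinite (by linarith)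
  · rw [map_zero]
    refine h (WithLp.toLp 2 y) (hball ?_)
    rw [ball_pi _ hε]
    exact hy

/-- A polynomial that vanishes along an affine projection onto the zero set of a nonconstant
affine function is divisible by that function. -/
theorem PolyDeg.exists_eq_mul_of_vanish {L : Vec d → ℝ} (hL : PolyDeg d 1 L)
    (hLc : ∃ x y, L x ≠ L y) (hf : PolyDeg d (ℓ + 1) f) (c : Vec d)
    {U : Set (Vec d)} (hU : IsOpen U) (hne : U.Nonempty)
    (h : ∀ x ∈ U, f (x - L x • c) = 0) :
    ∃ s, PolyDeg d ℓ s ∧ ∀ x, f x = L x * s x := by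
  obtain ⟨p, hp, hfp⟩ := hf
  obtain ⟨q, hq, hLq⟩ := hL
  have hq0 : q.totalDegree ≠ 0 := by
    intro h0
    obtain ⟨x, y, hxy⟩ := hLc
    rw [MvPolynomial.totalDegree_eq_zero_iff_eq_C.1 h0] at hLq
    exact hxy (by simp [hLq])
  set σ : Fin d → MvPolynomial (Fin d) ℝ :=
    fun j => MvPolynomial.X j - q * MvPolynomial.C (c j) with hσ
  have hbind : MvPolynomial.aeval σ p = 0 := by
    refine mvPolynomial_eq_zero_of_eval_eq_zero_on_open hU hne fun x hx => ?_
    have := h x hx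
    rw [hfp] at this
    rw [← this, MvPolynomial.map_aeval]
    exact MvPolynomial.eval₂Hom_congr (RingHom.ext fun r => by simp)
      (funext fun j => by simp [hσ, hLq]) rfl
  have hdvd : q ∣ p := by
    rw [← Ideal.mem_span_singleton, ← Ideal.Quotient.eq_zero_iff_mem]
    set π := Ideal.Quotient.mkₐ ℝ (Ideal.span {q}) with hπ
    have hcomp : π.comp (MvPolynomial.aeval σ) = π := by
      refine MvPolynomial.algHom_ext fun j => ?_
      have : π q = 0 := Ideal.Quotient.eq_zero_iff_mem.2 (Ideal.mem_span_singleton_self q)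
      simp [hσ, this]
    change π p = 0
    rw [← hcomp, AlgHom.comp_apply, hbind, map_zero]
  obtain ⟨s, rfl⟩ := hdvd
  refine ⟨fun x => MvPolynomial.eval (fun j => x j) s, ⟨s, ?_, fun _ => rfl⟩, fun x => ?_⟩
  · rcases eq_or_ne s 0 with rfl | hs
    · simp
    · rw [MvPolynomial.totalDegree_mul_of_isDomain (by rintro rfl; simp at hq0) hs] at hp
      omega
  · rw [hfp, hLq, map_mul]

end Polynomials

section Faces

variable {E : Type*} [NormedAddCommGroup E] [NormedSpace ℝ E]
  {n : ℕ} {y : Fin (n + 1) → E}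

theorem exists_affineMap_image_eq_convexHull (hy : AffineIndependent ℝ y) :
    ∃ (φ : (Fin n → ℝ) →ᵃ[ℝ] E) (S : Set (Fin n → ℝ)), Function.Injective φ ∧
      Convex ℝ S ∧ IsCompact S ∧ (interior S).Nonempty ∧
      φ '' S = convexHull ℝ (Set.range y) := by
  obtain ⟨β⟩ := AffineBasis.exists_affineBasis_of_finiteDimensional (ι := Fin (n + 1)) (k := ℝ)
    (P := Fin n → ℝ) (by simp)
  set φ : (Fin n → ℝ) →ᵃ[ℝ] E :=
    (Fintype.linearCombination ℝ y).toAffineMap.comp β.coords with hφ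
  have hφ_apply : ∀ s, φ s = ∑ m, β.coord m s • y m := by
    intro s
    simp [hφ, Fintype.linearCombination_apply]
  refine ⟨φ, convexHull ℝ (Set.range β), ?_, convex_convexHull ℝ _,
    (Set.finite_range β).isCompact_convexHull ℝ, ?_, ?_⟩
  · intro s s' hss
    rw [hφ_apply, hφ_apply] at hss
    refine β.ext_elem fun m => ?_
    refine congrFun ((affineIndependent_iff_eq_of_fintype_affineCombination_eq ℝ y).1 hy
      (fun m => β.coord m s) (fun m => β.coord m s') (β.sum_coord_apply_eq_one s)
      (β.sum_coord_apply_eq_one s') ?_) m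
    rwa [Finset.affineCombination_eq_linear_combination _ _ _ (β.sum_coord_apply_eq_one s),
      Finset.affineCombination_eq_linear_combination _ _ _ (β.sum_coord_apply_eq_one s')]
  · rw [interior_convexHull_nonempty_iff_affineSpan_eq_top]
    exact β.tot
  · rw [AffineMap.image_convexHull, ← Set.range_comp]
    congr 2
    funext m
    simp [hφ_apply, β.coord_apply]

variable [MeasurableSpace E] [BorelSpace E]

theorem hausdorffMeasure_convexHull_lt_top (hy : AffineIndependent ℝ y) :
    μH[(n : ℝ)] (convexHull ℝ (Set.range y)) < ⊤ := by
  obtain ⟨φ, S, -, -, hS, -, himg⟩ := exists_affineMap_image_eq_convexHull hy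
  have hvol : (μH[(n : ℝ)] : Measure (Fin n → ℝ)) = volume := by
    simpa using hausdorffMeasure_pi_real (ι := Fin n)
  obtain ⟨K, hK⟩ : ∃ K, LipschitzWith K φ := by
    refine ⟨‖LinearMap.toContinuousLinearMap φ.linear‖₊,
      LipschitzWith.of_dist_le_mul fun s s' => ?_⟩
    rw [dist_eq_norm, ← vsub_eq_sub, ← φ.linearMap_vsub, dist_eq_norm, vsub_eq_sub]
    exact (LinearMap.toContinuousLinearMap φ.linear).le_opNorm (s - s')
  rw [← himg]
  refine (hK.hausdorffMeasure_image_le n.cast_nonneg S).trans_lt ?_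
  rw [hvol]
  exact ENNReal.mul_lt_top (ENNReal.rpow_lt_top_of_nonneg n.cast_nonneg ENNReal.coe_ne_top)
    hS.measure_lt_top

theorem eqOn_zero_of_ae_hausdorffMeasure (hy : AffineIndependent ℝ y) {f : E → ℝ}
    (hf : Continuous f)
    (h : f =ᵐ[μH[(n : ℝ)].restrict (convexHull ℝ (Set.range y))] 0) :
    Set.EqOn f 0 (convexHull ℝ (Set.range y)) := by
  obtain ⟨φ, S, hinj, hconv, hS, hne, himg⟩ := exists_affineMap_image_eq_convexHull hy
  have hvol : (μH[(n : ℝ)] : Measure (Fin n → ℝ)) = volume := by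
    simpa using hausdorffMeasure_pi_real (ι := Fin n)
  obtain ⟨K, hK⟩ := AffineMap.antilipschitzWith_of_finiteDimensional hinj
  have hφ : Continuous φ := φ.continuous_of_finiteDimensional
  have hmeas : MeasurableSet (convexHull ℝ (Set.range y)) :=
    ((Set.finite_range y).isCompact_convexHull ℝ).measurableSet
  rw [← himg] at h hmeas ⊢
  rw [Filter.EventuallyEq, ae_restrict_iff' hmeas, ae_iff] at h
  have hpre : f ∘ φ =ᵐ[volume.restrict S] 0 := by
    rw [Filter.EventuallyEq, ae_restrict_iff' hS.measurableSet, ae_iff, ← hvol]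
    refine measure_mono_null ?_ (le_antisymm
      ((hK.hausdorffMeasure_preimage_le n.cast_nonneg _).trans_eq (by rw [h, mul_zero])) zero_le)
    intro s hs
    simpa [hinj.eq_iff] using hs
  have := Measure.eqOn_of_ae_eq hpre (hf.comp hφ).continuousOn continuousOn_const
    (by rw [hconv.closure_interior_eq_closure_of_nonempty_interior hne]; exact subset_closure)
  rintro _ ⟨s, hs, rfl⟩
  exact this hs

end Faces

section Simplex

variable (b : AffineBasis (Fin (d + 1)) ℝ (Vec d))

theorem coord_eq_zero_of_mem_face {i : Fin (d + 1)} {x : Vec d}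
    (hx : x ∈ convexHull ℝ (b '' {i}ᶜ)) : b.coord i x = 0 := by
  have hsub : convexHull ℝ (b '' {i}ᶜ) ⊆ b.coord i ⁻¹' {0} := by
    refine convexHull_min ?_ ((convex_singleton 0).affine_preimage _)
    rintro _ ⟨j, hj, rfl⟩
    exact b.coord_apply_ne (Ne.symm hj)
  exact hsub hx

theorem sub_coord_smul_mem_face {i j : Fin (d + 1)} (hij : j ≠ i) {x : Vec d}
    (hx : x ∈ convexHull ℝ (Set.range b)) :
    x - b.coord i x • (b i - b j) ∈ convexHull ℝ (b '' {i}ᶜ) := by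
  set π : Vec d →ᵃ[ℝ] Vec d := AffineMap.id ℝ (Vec d) -
    (LinearMap.toSpanSingleton ℝ (Vec d) (b i - b j)).toAffineMap.comp (b.coord i) with hπ
  have hπ_apply : ∀ z, π z = z - b.coord i z • (b i - b j) := fun z => by simp [hπ]
  have hsub : convexHull ℝ (Set.range b) ⊆ π ⁻¹' convexHull ℝ (b '' {i}ᶜ) := by
    refine convexHull_min ?_ ((convex_convexHull ℝ _).affine_preimage _)
    rintro _ ⟨m, rfl⟩
    rw [Set.mem_preimage, hπ_apply]
    refine subset_convexHull ℝ _ ?_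
    rcases eq_or_ne m i with rfl | hm
    · exact ⟨j, hij, by simp⟩
    · exact ⟨m, hm, by simp [b.coord_apply_ne hm.symm]⟩
  have := hsub hx
  rwa [Set.mem_preimage, hπ_apply] at this

theorem polyDeg_one_coord (i : Fin (d + 1)) {G : Vec d}
    (hG : ∀ z, ⟪z, G⟫ = (b.coord i).linear z) : PolyDeg d 1 (b.coord i) := by
  have h : (b.coord i : Vec d → ℝ) = fun x => ⟪x, G⟫ + b.coord i 0 := by
    funext x
    have := (b.coord i).linearMap_vsub x 0
    simp only [vsub_eq_sub, sub_zero] at this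
    rw [hG, this, sub_add_cancel]
  rw [h]
  exact (VPolyDeg.inner_const (fun j => PolyDeg.coord j) G).add (PolyDeg.const 1 _)

theorem sum_linear_coord (z : Vec d) : ∑ i, (b.coord i).linear z = 0 := by
  have h : ∀ i, (b.coord i).linear z = b.coord i z - b.coord i 0 := fun i => by
    simpa using (b.coord i).linearMap_vsub z 0
  simp only [h, Finset.sum_sub_distrib, b.sum_coord_apply_eq_one, sub_self]

theorem face_eq_convexHull_range_succAbove (y : Fin (d + 1) → Vec d) (i : Fin (d + 1)) :
    convexHull ℝ (y '' {i}ᶜ) = convexHull ℝ (Set.range (y ∘ i.succAbove)) := by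
  rw [Set.range_comp, Fin.range_succAbove]

end Simplex

theorem sμ_face_lt_top {n : ℕ} {y : Fin (n + 1 + 1) → Vec (n + 1)} (hy : AffineIndependent ℝ y)
    (i : Fin (n + 1 + 1)) : sμ (n + 1) (convexHull ℝ (y '' {i}ᶜ)) < ⊤ := by
  have := hausdorffMeasure_convexHull_lt_top (hy.comp_embedding i.succAboveEmb)
  rw [face_eq_convexHull_range_succAbove]
  simpa [sμ] using this

theorem eqOn_zero_of_ae_sμ_face {n : ℕ} {y : Fin (n + 1 + 1) → Vec (n + 1)}
    (hy : AffineIndependent ℝ y) (i : Fin (n + 1 + 1)) {f : Vec (n + 1) → ℝ} (hf : Continuous f)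
    (h : f =ᵐ[(sμ (n + 1)).restrict (convexHull ℝ (y '' {i}ᶜ))] 0) :
    Set.EqOn f 0 (convexHull ℝ (y '' {i}ᶜ)) := by
  rw [face_eq_convexHull_range_succAbove] at h ⊢
  refine eqOn_zero_of_ae_hausdorffMeasure (hy.comp_embedding i.succAboveEmb) hf ?_
  simpa [sμ] using h

/-- Unisolvence of the Raviart–Thomas–Nédélec degrees of freedom on a simplex. -/
theorem IsRTN.eqOn_zero_of_moments {n m : ℕ}
    (b : AffineBasis (Fin (n + 1 + 1)) ℝ (Vec (n + 1))) {G : Fin (n + 1 + 1) → Vec (n + 1)}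
    (hG : ∀ i z, ⟪z, G i⟫ = (b.coord i).linear z) {E : Vec (n + 1) → Vec (n + 1)}
    (hE : IsRTN (n + 1) (m + 1) E)
    (hcell : ∀ w, VPolyDeg (n + 1) m w →
      ∫ x in interior (convexHull ℝ (Set.range b)), ⟪E x, w x⟫ = (0 : ℝ))
    (hface : ∀ i q, PolyDeg (n + 1) (m + 1) q →
      ∫ x in convexHull ℝ (b '' {i}ᶜ), ⟪E x, G i⟫ * q x ∂(sμ (n + 1)) = (0 : ℝ)) :
    Set.EqOn E 0 (interior (convexHull ℝ (Set.range b))) := by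
  set T := interior (convexHull ℝ (Set.range b)) with hT
  have hTne : T.Nonempty := by
    rw [hT, interior_convexHull_nonempty_iff_affineSpan_eq_top]
    exact b.tot
  have hEc := hE.continuous
  obtain ⟨a, q, ha, hq, hEq⟩ := hE
  have hlin : ∀ i x, ⟪E x, G i⟫ =
      (⟪a x, G i⟫ - q x * b.coord i 0) + b.coord i x * q x := by
    intro i x
    have h : (b.coord i).linear x = b.coord i x - b.coord i 0 := by
      simpa using (b.coord i).linearMap_vsub x 0
    rw [hEq, inner_add_left, real_inner_smul_left, hG i x, h]
    ring
  have hdiv : ∀ i, ∃ s, PolyDeg (n + 1) m s ∧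
      ∀ x, ⟪a x, G i⟫ - q x * b.coord i 0 = b.coord i x * s x := by
    intro i
    have hh : PolyDeg (n + 1) (m + 1) (fun x => ⟪a x, G i⟫ - q x * b.coord i 0) :=
      (ha.inner_const (G i)).sub (hq.mul_const _)
    have hzero : Set.EqOn (fun x => ⟪a x, G i⟫ - q x * b.coord i 0) 0
        (convexHull ℝ (b '' {i}ᶜ)) := by
      have hcpt : IsCompact (convexHull ℝ (b '' {i}ᶜ)) :=
        (Set.toFinite _).isCompact_convexHull ℝ
      have hint := hface i _ hh
      rw [setIntegral_congr_fun (g := fun x => (⟪a x, G i⟫ - q x * b.coord i 0) ^ 2)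
        hcpt.measurableSet (fun x hx => by
          simp only [hlin i x, coord_eq_zero_of_mem_face b hx]
          ring),
        setIntegral_eq_zero_iff_of_nonneg_ae (Filter.Eventually.of_forall fun x => sq_nonneg _)
          ((hh.continuous.pow 2).continuousOn.integrableOn_of_subset_isCompact hcpt
            hcpt.measurableSet subset_rfl (sμ_face_lt_top b.ind i).ne)] at hint
      refine eqOn_zero_of_ae_sμ_face b.ind i hh.continuous (hint.mono fun x hx => ?_)
      exact pow_eq_zero_iff two_ne_zero |>.1 hx
    obtain ⟨j, hj⟩ := exists_ne i
    refine (polyDeg_one_coord b i (hG i)).exists_eq_mul_of_vanish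
      ⟨b i, b j, by simp [b.coord_apply_ne hj.symm]⟩ hh (b i - b j) isOpen_interior hTne
      fun x hx => hzero (sub_coord_smul_mem_face b hj (interior_subset hx))
  choose r hr hr_eq using hdiv
  have hfactor : ∀ i x, ⟪E x, G i⟫ = b.coord i x * (r i x + q x) := fun i x => by
    rw [hlin, hr_eq]
    ring
  have hsum : ∀ x, ∑ i, b.coord i x * (r i x + q x) = 0 := fun x => by
    simp only [← hfactor, hG, sum_linear_coord]
  have hinner : ∀ x, ⟪E x, ∑ i, r i x • G i⟫ = ∑ i, b.coord i x * (r i x + q x) ^ 2 := by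
    intro x
    have h : ∑ i, b.coord i x * (r i x + q x) ^ 2 = ∑ i, r i x * (b.coord i x * (r i x + q x))
        + q x * ∑ i, b.coord i x * (r i x + q x) := by
      rw [Finset.mul_sum, ← Finset.sum_add_distrib]
      exact Finset.sum_congr rfl fun i _ => by ring
    rw [h, hsum, mul_zero, add_zero, inner_sum]
    exact Finset.sum_congr rfl fun i _ => by rw [real_inner_smul_right, hfactor]
  have hw : VPolyDeg (n + 1) m (fun x => ∑ i, r i x • G i) :=
    VPolyDeg.sum _ fun i _ => (hr i).smul_const (G i)
  have hpos : ∀ x ∈ T, ∀ i, 0 < b.coord i x := fun x hx => by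
    rw [hT, b.interior_convexHull] at hx
    exact hx
  have hnonneg : ∀ x ∈ T, ∀ i, 0 ≤ b.coord i x * (r i x + q x) ^ 2 := fun x hx i =>
    mul_nonneg (hpos x hx i).le (sq_nonneg _)
  have hcpt : IsCompact (convexHull ℝ (Set.range b)) := (Set.finite_range b).isCompact_convexHull ℝ
  have hcont : Continuous fun x => ⟪E x, ∑ i, r i x • G i⟫ := hEc.inner hw.continuous
  have hint := hcell _ hw
  rw [setIntegral_eq_zero_iff_of_nonneg_ae ?_
    ((hcont.continuousOn.integrableOn_compact hcpt).mono_set interior_subset)] at hint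
  swap
  · refine (ae_restrict_iff' isOpen_interior.measurableSet).2 (Filter.Eventually.of_forall ?_)
    intro x hx
    simp only [hinner, Pi.zero_apply]
    exact Finset.sum_nonneg fun i _ => hnonneg x hx i
  have hzero := Measure.eqOn_open_of_ae_eq hint isOpen_interior hcont.continuousOn
    continuousOn_const
  intro x hx
  have hx0 := hzero hx
  simp only [hinner, Pi.zero_apply] at hx0
  rw [Finset.sum_eq_zero_iff_of_nonneg fun i _ => hnonneg x hx i] at hx0
  have hcoord : ∀ i, (b.coord i).linear (E x) = 0 := fun i => by
    rcases mul_eq_zero.1 (hx0 i (Finset.mem_univ i)) with h | h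
    · exact absurd h (hpos x hx i).ne'
    · rw [← hG, hfactor, pow_eq_zero_iff two_ne_zero |>.1 h, mul_zero]
  refine b.ext_elem fun i => ?_
  have := (b.coord i).linearMap_vsub (E x) 0
  simp only [vsub_eq_sub, sub_zero, hcoord] at this
  simpa using (sub_eq_zero.1 this.symm)

namespace Mesh

variable (M : Mesh d) (t : Fin M.nE)

/-- The affine basis formed by the vertices of an element. -/
def affineBasis : AffineBasis (Fin (d + 1)) ℝ (Vec d) :=
  ⟨M.vtx t, M.indep t, by
    rw [(M.indep t).affineSpan_eq_top_iff_card_eq_finrank_add_one]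
    simp⟩

/-- The gradient of a barycentric coordinate is a multiple of the normal to the opposite face. -/
theorem exists_inner_smul_nrm_eq_coord [Nontrivial (Fin (d + 1))] (i : Fin (d + 1)) :
    ∃ c : ℝ, ∀ z, ⟪z, c • M.nrm t i⟫ = ((M.affineBasis t).coord i).linear z := by
  obtain ⟨j, hj⟩ := exists_ne i
  set b := M.affineBasis t with hb
  set κ : ℝ := ⟪M.vtx t i - M.vtx t j, M.nrm t i⟫ with hκ
  have hκ0 : κ ≠ 0 := (M.nrm_out t i j hj).ne
  have haff : ∀ x, ⟪x - M.vtx t j, M.nrm t i⟫ = b.coord i x * κ := by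
    intro x
    have hx : x - M.vtx t j = ∑ m, b.coord m x • (M.vtx t m - M.vtx t j) := by
      simp only [smul_sub, Finset.sum_sub_distrib, ← Finset.sum_smul, b.sum_coord_apply_eq_one,
        one_smul]
      congr 1
      exact (b.linear_combination_coord_eq_self x).symm
    rw [hx, sum_inner, Finset.sum_eq_single i]
    · rw [real_inner_smul_left]
    · intro m _ hm
      rw [real_inner_smul_left, M.nrm_orth t i m j hm hj, mul_zero]
    · simp
  refine ⟨κ⁻¹, fun z => ?_⟩
  have hz := (b.coord i).linearMap_vsub (z + M.vtx t j) (M.vtx t j)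
  have h0 : b.coord i (M.vtx t j) = 0 := b.coord_apply_ne hj.symm
  have h1 := haff (z + M.vtx t j)
  simp only [vsub_eq_sub, add_sub_cancel_right, h0, sub_zero] at hz h1
  rw [hz, real_inner_smul_right, h1]
  field_simp

end Mesh

theorem integral_sub_add_eq_zero {α : Type*} [MeasurableSpace α] {μ : Measure α} {f g h : α → ℝ}
    (hf : Integrable f μ) (hg : Integrable g μ) (hh : Integrable h μ) (hf0 : ∫ x, f x ∂μ = 0)
    (hg0 : ∫ x, g x ∂μ = 0) (hh0 : ∫ x, h x ∂μ = 0) : ∫ x, (f x - g x + h x) ∂μ = 0 := by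
  rw [integral_add (f := fun x => f x - g x) (hf.sub hg) hh, integral_sub hf hg, hf0, hg0, hh0]
  simp

theorem darcy_reconstruction_of_interpolate (d k : ℕ) (hk : 1 ≤ k)
    (M : Mesh d) (t : Fin M.nE) (v : Vec d → Vec d)
    (hv : ContDiffOn ℝ 1 v (convexHull ℝ (Set.range (M.vtx t))))
    (u : Tup d) (hu : IsInterp M k (max (k - 1) 1) t v u)
    (R : Vec d → Vec d) (hR : IsDarcyRec M k t u R)
    (Q : Vec d → Vec d) (hQ : IsRTNInterp M k t v Q) :
    Set.EqOn R Q (M.cell t) := by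
  rcases d with _ | n
  · exact fun x _ => Subsingleton.elim _ _
  obtain ⟨m, rfl⟩ : ∃ m, k = m + 1 := ⟨k - 1, by omega⟩
  obtain ⟨hu_cell, hu_face⟩ := hu
  obtain ⟨hR_rtn, hR_cell, hR_face⟩ := hR
  obtain ⟨hQ_rtn, hQ_cell, hQ_face⟩ := hQ
  rw [Nat.add_sub_cancel] at hR_cell hQ_cell hu_cell
  have hKcpt : IsCompact (convexHull ℝ (Set.range (M.vtx t))) :=
    (Set.finite_range _).isCompact_convexHull ℝ
  have hvc := hv.continuousOn
  have hRc := hR_rtn.continuous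
  have hQc := hQ_rtn.continuous
  choose c hc using M.exists_inner_smul_nrm_eq_coord t
  have hmain := (hR_rtn.sub hQ_rtn).eqOn_zero_of_moments (M.affineBasis t) hc ?_ ?_
  · exact fun x hx => sub_eq_zero.1 (hmain hx)
  · intro w hw
    have hwc := hw.continuous
    have huc := hu_cell.1.continuous
    have hint : ∀ g : Vec (n + 1) → ℝ, ContinuousOn g (convexHull ℝ (Set.range (M.vtx t))) →
        IntegrableOn g (M.cell t) := fun g hg =>
      (hg.integrableOn_compact hKcpt).mono_set interior_subset
    have h := integral_sub_add_eq_zero (hint (fun x => ⟪R x - u.1 x, w x⟫) (by fun_prop))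
      (hint (fun x => ⟪v x - u.1 x, w x⟫) (by fun_prop))
      (hint (fun x => ⟪v x - Q x, w x⟫) (by fun_prop))
      (hR_cell w hw) (hu_cell.2 w (hw.mono (le_max_left _ _))) (hQ_cell w hw)
    rw [← h]
    refine integral_congr_ae (Filter.Eventually.of_forall fun x => ?_)
    simp only [inner_sub_left]
    ring
  · intro i q hq
    have hqc := hq.continuous
    have huc := (hu_face i).1.continuous
    have hFK : M.face t i ⊆ convexHull ℝ (Set.range (M.vtx t)) :=
      convexHull_mono (Set.image_subset_range _ _)
    have hFm : MeasurableSet (M.face t i) :=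
      ((Set.toFinite _).isCompact_convexHull ℝ).measurableSet
    have hint : ∀ g : Vec (n + 1) → ℝ, ContinuousOn g (convexHull ℝ (Set.range (M.vtx t))) →
        IntegrableOn g (M.face t i) (sμ (n + 1)) := fun g hg =>
      hg.integrableOn_of_subset_isCompact hKcpt hFm hFK (sμ_face_lt_top (M.indep t) i).ne
    have h := integral_sub_add_eq_zero
      (hint (fun x => (⟪R x, M.nrm t i⟫ - ⟪u.2 i x, M.nrm t i⟫) * q x) (by fun_prop))
      (hint (fun x => ⟪v x - u.2 i x, q x • M.nrm t i⟫) (by fun_prop))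
      (hint (fun x => (⟪v x, M.nrm t i⟫ - ⟪Q x, M.nrm t i⟫) * q x) (by fun_prop))
      (hR_face i q hq) ((hu_face i).2 _ (hq.smul_const _)) (hQ_face i q hq)
    rw [← mul_zero (c i), ← h, ← integral_const_mul]
    refine integral_congr_ae (Filter.Eventually.of_forall fun x => ?_)
    simp only [inner_sub_left, real_inner_smul_right]
    ring

end HHO
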